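/- Let R be a GF-closed ring such that both the left weak Gorenstein global dimension l.Gwdim(R) and the right weak Gorenstein global dimension r.Gwdim(R) are finite. Then l.Gwdim(R) = r.Gwdim(R). -/

import Mathlib

/-!
Background definitions for D. Bennis, "Weak Gorenstein global dimensions".

Conventions.  All rings are associative with identity.  A *left* `R`-module is a type with
`[AddCommGroup M] [Module R M]`; a *right* `R`-module is a left module over the opposite ring,
i.e. `[Module Rᵐᵒᵖ M]`.  All "right-handed" notions below are obtained by applying the
corresponding "left-handed" notion to the opposite ring `Rᵐᵒᵖ`.
-/

open MulOpposite

universe u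

section Tensor

variable (S : Type u) [Ring S]

/-- The subgroup of relations defining the tensor product `A ⊗_S M` of a right `S`-module `A`
and a left `S`-module `M` over a (possibly noncommutative) ring `S`. -/
def tensorRels (A : Type u) [AddCommGroup A] [Module Sᵐᵒᵖ A]
    (M : Type u) [AddCommGroup M] [Module S M] :
    AddSubgroup (FreeAbelianGroup (A × M)) :=
  AddSubgroup.closure
    { x | (∃ a₁ a₂ m, x = FreeAbelianGroup.of (a₁ + a₂, m) - FreeAbelianGroup.of (a₁, m) -
            FreeAbelianGroup.of (a₂, m)) ∨
          (∃ a m₁ m₂, x = FreeAbelianGroup.of (a, m₁ + m₂) - FreeAbelianGroup.of (a, m₁) -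
            FreeAbelianGroup.of (a, m₂)) ∨
          (∃ (a : A) (r : S) (m : M), x = FreeAbelianGroup.of (op r • a, m) - FreeAbelianGroup.of (a, r • m)) }

/-- The tensor product `A ⊗_S M` (an abelian group) of a right `S`-module `A` and a left
`S`-module `M` over a (possibly noncommutative) ring `S`. -/
def NTensor (A : Type u) [AddCommGroup A] [Module Sᵐᵒᵖ A]
    (M : Type u) [AddCommGroup M] [Module S M] : Type u :=
  FreeAbelianGroup (A × M) ⧸ tensorRels S A M

instance (A : Type u) [AddCommGroup A] [Module Sᵐᵒᵖ A]
    (M : Type u) [AddCommGroup M] [Module S M] : AddCommGroup (NTensor S A M) :=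
  QuotientAddGroup.Quotient.addCommGroup _

namespace NTensor

variable {S}
variable {A A' : Type u} [AddCommGroup A] [Module Sᵐᵒᵖ A] [AddCommGroup A'] [Module Sᵐᵒᵖ A']
variable {M M' : Type u} [AddCommGroup M] [Module S M] [AddCommGroup M'] [Module S M']

/-- Functoriality of `A ⊗_S −` : the map `A ⊗_S M → A ⊗_S M'` induced by a linear map
`g : M → M'` of left `S`-modules. -/
def rmap (A : Type u) [AddCommGroup A] [Module Sᵐᵒᵖ A] (g : M →ₗ[S] M') :
    NTensor S A M →+ NTensor S A M' :=
  QuotientAddGroup.map (tensorRels S A M) (tensorRels S A M') (FreeAbelianGroup.map (Prod.map id g)) (by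
    simp only [tensorRels]
    refine (AddSubgroup.closure_le _).2 ?_
    rintro x (⟨a₁, a₂, m, rfl⟩ | ⟨a, m₁, m₂, rfl⟩ | ⟨a, r, m, rfl⟩) <;>
      refine SetLike.mem_coe.2 (AddSubgroup.mem_comap.2 (AddSubgroup.subset_closure ?_)) <;>
      simp only [map_sub, map_add, map_smul, FreeAbelianGroup.map_of_apply, Prod.map_apply,
        id_eq, Set.mem_setOf_eq]
    · exact Or.inl ⟨a₁, a₂, g m, rfl⟩
    · exact Or.inr (Or.inl ⟨a, g m₁, g m₂, rfl⟩)
    · exact Or.inr (Or.inr ⟨a, r, g m, rfl⟩))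

/-- Functoriality of `− ⊗_S M` : the map `A ⊗_S M → A' ⊗_S M` induced by a linear map
`f : A → A'` of right `S`-modules. -/
def lmap (M : Type u) [AddCommGroup M] [Module S M] (f : A →ₗ[Sᵐᵒᵖ] A') :
    NTensor S A M →+ NTensor S A' M :=
  QuotientAddGroup.map (tensorRels S A M) (tensorRels S A' M) (FreeAbelianGroup.map (Prod.map f id)) (by
    simp only [tensorRels]
    refine (AddSubgroup.closure_le _).2 ?_
    rintro x (⟨a₁, a₂, m, rfl⟩ | ⟨a, m₁, m₂, rfl⟩ | ⟨a, r, m, rfl⟩) <;>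
      refine SetLike.mem_coe.2 (AddSubgroup.mem_comap.2 (AddSubgroup.subset_closure ?_)) <;>
      simp only [map_sub, map_add, map_smul, FreeAbelianGroup.map_of_apply, Prod.map_apply,
        id_eq, Set.mem_setOf_eq]
    · exact Or.inl ⟨f a₁, f a₂, m, rfl⟩
    · exact Or.inr (Or.inl ⟨f a, m₁, m₂, rfl⟩)
    · exact Or.inr (Or.inr ⟨f a, r, m, rfl⟩))

end NTensor

end Tensor

section Dims

variable (S : Type u) [Ring S]

/-- A left `S`-module `M` is *flat* if tensoring with it preserves injectivity of maps of
right `S`-modules. -/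
def IsFlatMod (M : ModuleCat.{u} S) : Prop :=
  ∀ (A B : Type u) [AddCommGroup A] [Module Sᵐᵒᵖ A] [AddCommGroup B] [Module Sᵐᵒᵖ B]
    (f : A →ₗ[Sᵐᵒᵖ] B), Function.Injective f →
      Function.Injective (NTensor.lmap (↥M) f)

/-- A left `S`-module `M` is *Gorenstein flat* if there is an exact sequence
`⋯ → F (-1) → F 0 → F 1 → ⋯` of flat left `S`-modules with `M ≅ Im (F 0 → F 1)` which stays
exact after applying `I ⊗_S −` for every injective right `S`-module `I`
(a *complete flat resolution*). -/
def IsGorensteinFlat (M : ModuleCat.{u} S) : Prop :=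
  ∃ (F : ℤ → ModuleCat.{u} S) (d : ∀ n : ℤ, ↥(F n) →ₗ[S] ↥(F (n + 1))),
    (∀ n, IsFlatMod S (F n)) ∧
    (∀ n, Function.Exact (d n) (d (n + 1))) ∧
    Nonempty (↥M ≃ₗ[S] ↥(LinearMap.range (d 0))) ∧
    (∀ (I : Type u) [AddCommGroup I] [Module Sᵐᵒᵖ I], Module.Injective Sᵐᵒᵖ I →
      ∀ n, Function.Exact (NTensor.rmap I (d n)) (NTensor.rmap I (d (n + 1))))

/-- `gflatDimLE S n M` means `Gfd_S(M) ≤ n`: there is an exact sequence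
`0 → G_n → ⋯ → G_0 → M → 0` of left `S`-modules with all `G_i` Gorenstein flat. -/
def gflatDimLE : ℕ → ModuleCat.{u} S → Prop
  | 0, M => IsGorensteinFlat S M
  | n + 1, M => ∃ (K G : ModuleCat.{u} S) (ι : ↥K →ₗ[S] ↥G) (π : ↥G →ₗ[S] ↥M),
      Function.Injective ι ∧ Function.Surjective π ∧ Function.Exact ι π ∧
      IsGorensteinFlat S G ∧ gflatDimLE n K

/-- `flatDimLE S n M` means `fd_S(M) ≤ n`: there is an exact sequence
`0 → F_n → ⋯ → F_0 → M → 0` of left `S`-modules with all `F_i` flat. -/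
def flatDimLE : ℕ → ModuleCat.{u} S → Prop
  | 0, M => IsFlatMod S M
  | n + 1, M => ∃ (K F : ModuleCat.{u} S) (ι : ↥K →ₗ[S] ↥F) (π : ↥F →ₗ[S] ↥M),
      Function.Injective ι ∧ Function.Surjective π ∧ Function.Exact ι π ∧
      IsFlatMod S F ∧ flatDimLE n K

/-- `injDimLE S n M` means `id_S(M) ≤ n`: there is an exact sequence
`0 → M → I^0 → ⋯ → I^n → 0` of left `S`-modules with all `I^i` injective. -/
def injDimLE : ℕ → ModuleCat.{u} S → Prop
  | 0, M => Module.Injective S ↥M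
  | n + 1, M => ∃ (I C : ModuleCat.{u} S) (ι : ↥M →ₗ[S] ↥I) (π : ↥I →ₗ[S] ↥C),
      Function.Injective ι ∧ Function.Surjective π ∧ Function.Exact ι π ∧
      Module.Injective S ↥I ∧ injDimLE n C

/-- The Gorenstein flat dimension `Gfd_S(M) ∈ ℕ∞` of a left `S`-module `M`. -/
noncomputable def gflatDim (M : ModuleCat.{u} S) : ℕ∞ :=
  sInf {d : ℕ∞ | ∃ n : ℕ, d = n ∧ gflatDimLE S n M}

/-- The flat dimension `fd_S(M) ∈ ℕ∞` of a left `S`-module `M`. -/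
noncomputable def flatDim (M : ModuleCat.{u} S) : ℕ∞ :=
  sInf {d : ℕ∞ | ∃ n : ℕ, d = n ∧ flatDimLE S n M}

/-- The injective dimension `id_S(M) ∈ ℕ∞` of a left `S`-module `M`. -/
noncomputable def injDim (M : ModuleCat.{u} S) : ℕ∞ :=
  sInf {d : ℕ∞ | ∃ n : ℕ, d = n ∧ injDimLE S n M}

/-- The left weak Gorenstein global dimension
`l.Gwdim(S) = sup { Gfd_S(M) | M a left S-module }`.  The right weak Gorenstein global
dimension of `S` is `gorensteinWeakGlobalDim Sᵐᵒᵖ`. -/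
noncomputable def gorensteinWeakGlobalDim : ℕ∞ :=
  ⨆ M : ModuleCat.{u} S, gflatDim S M

/-- The left weak global dimension `sup { fd_S(M) | M a left S-module }`.  (By a classical
theorem it agrees with `weakGlobalDim Sᵐᵒᵖ`, and the common value is `wdim S`.) -/
noncomputable def weakGlobalDim : ℕ∞ :=
  ⨆ M : ModuleCat.{u} S, flatDim S M

/-- The left finitistic flat dimension
`l.FFD(S) = sup { fd_S(M) | M a left S-module with fd_S(M) < ∞ }`. -/
noncomputable def finitisticFlatDim : ℕ∞ :=
  sSup {d : ℕ∞ | d ≠ ⊤ ∧ ∃ M : ModuleCat.{u} S, flatDim S M = d}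

/-- The left finitistic Gorenstein flat dimension
`l.FGFD(S) = sup { Gfd_S(M) | M a left S-module with Gfd_S(M) < ∞ }`. -/
noncomputable def finitisticGFlatDim : ℕ∞ :=
  sSup {d : ℕ∞ | d ≠ ⊤ ∧ ∃ M : ModuleCat.{u} S, gflatDim S M = d}

/-- A ring `S` is *left GF-closed* if the class of Gorenstein flat left `S`-modules is closed
under extensions.  `S` is right GF-closed iff `Sᵐᵒᵖ` is left GF-closed, and GF-closed if both. -/
def IsGFClosed : Prop :=
  ∀ (A B C : ModuleCat.{u} S) (f : ↥A →ₗ[S] ↥B) (g : ↥B →ₗ[S] ↥C),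
    Function.Injective f → Function.Surjective g → Function.Exact f g →
      IsGorensteinFlat S A → IsGorensteinFlat S C → IsGorensteinFlat S B

/-- A ring `S` is *left coherent* if every finitely generated left ideal of `S` is finitely
presented (as a left `S`-module).  `S` is right coherent iff `Sᵐᵒᵖ` is left coherent. -/
def IsLeftCoherent : Prop :=
  ∀ I : Submodule S S, I.FG → Module.FinitePresentation S ↥I

/-- A ring `S` is *left IF* if every injective left `S`-module is flat.  `S` is right IF iff
`Sᵐᵒᵖ` is left IF, and IF if both. -/
def IsLeftIF : Prop :=
  ∀ E : ModuleCat.{u} S, Module.Injective S ↥E → IsFlatMod S E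

/-- A ring `S` is *left `n`-IF* if `fd_S(E) ≤ n` for every injective left `S`-module `E`.
`S` is right `n`-IF iff `Sᵐᵒᵖ` is left `n`-IF, and `n`-IF if both. -/
def IsLeftNIF (n : ℕ) : Prop :=
  ∀ E : ModuleCat.{u} S, Module.Injective S ↥E → flatDim S E ≤ (n : ℕ∞)

/-- `Ext¹_S(T, K) = 0`, expressed by its standard characterization: every extension of `T`
by `K` (i.e. every short exact sequence `0 → K → X → T → 0`) splits. -/
def Ext1Zero (T K : ModuleCat.{u} S) : Prop :=
  ∀ (X : ModuleCat.{u} S) (ι : ↥K →ₗ[S] ↥X) (π : ↥X →ₗ[S] ↥T),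
    Function.Injective ι → Function.Surjective π → Function.Exact ι π →
      ∃ ρ : ↥X →ₗ[S] ↥K, ρ.comp ι = LinearMap.id

/-- A left `S`-module `K` is *cotorsion* if `Ext¹_S(F, K) = 0` for every flat left
`S`-module `F`. -/
def IsCotorsion (K : ModuleCat.{u} S) : Prop :=
  ∀ F : ModuleCat.{u} S, IsFlatMod S F → Ext1Zero S F K

/-- `Tor₁^S(A, T) = 0` for a right `S`-module `A` and a left `S`-module `T`, expressed by its
standard characterization: for every short exact sequence `0 → K → F → T → 0` of left
`S`-modules with `F` flat, the induced map `A ⊗_S K → A ⊗_S F` is injective. -/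
def Tor1Zero (A : Type u) [AddCommGroup A] [Module Sᵐᵒᵖ A] (T : ModuleCat.{u} S) : Prop :=
  ∀ (K F : ModuleCat.{u} S) (ι : ↥K →ₗ[S] ↥F) (π : ↥F →ₗ[S] ↥T),
    IsFlatMod S F → Function.Injective ι → Function.Surjective π → Function.Exact ι π →
      Function.Injective (NTensor.rmap A ι)

/-- A left `S`-module is *finitely presented* if it admits a presentation with finitely many
generators and relations. -/
abbrev IsFinitelyPresented (M : ModuleCat.{u} S) : Prop :=
  Module.FinitePresentation S ↥M

end Dims

section Duality

open CategoryTheory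

/-- The character module `Hom_ℤ(A, ℚ/ℤ)` of a right `S`-module `A`, as a left `S`-module. -/
def RightDual (A : Type u) [AddCommGroup A] : Type u := CharacterModule A

/-- The character module `Hom_ℤ(M, ℚ/ℤ)` of a left `S`-module `M`, as a right `S`-module. -/
def LeftDual (M : Type u) [AddCommGroup M] : Type u := CharacterModule M

namespace RightDual

variable {S : Type u} [Ring S] {A B : Type u} [AddCommGroup A] [Module Sᵐᵒᵖ A]
  [AddCommGroup B] [Module Sᵐᵒᵖ B]

instance : AddCommGroup (RightDual A) := inferInstanceAs (AddCommGroup (A →+ AddCircle (1 : ℚ)))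

instance : FunLike (RightDual A) A (AddCircle (1 : ℚ)) :=
  inferInstanceAs (FunLike (A →+ AddCircle (1 : ℚ)) A _)

instance : AddMonoidHomClass (RightDual A) A (AddCircle (1 : ℚ)) :=
  inferInstanceAs (AddMonoidHomClass (A →+ AddCircle (1 : ℚ)) A _)

@[ext] theorem ext {φ ψ : RightDual A} (h : ∀ a, φ a = ψ a) : φ = ψ := DFunLike.ext _ _ h

@[simp] theorem add_apply (φ ψ : RightDual A) (a : A) : (φ + ψ) a = φ a + ψ a := rfl

@[simp] theorem zero_apply (a : A) : (0 : RightDual A) a = 0 := rfl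

instance : Module S (RightDual A) where
  smul r φ := AddMonoidHom.comp (show A →+ AddCircle (1 : ℚ) from φ)
    (DistribSMul.toAddMonoidHom A (op r))
  one_smul φ := ext fun a => congrArg φ (one_smul Sᵐᵒᵖ a)
  mul_smul r s φ := ext fun a => congrArg φ (mul_smul (op s) (op r) a)
  smul_zero _ := rfl
  smul_add _ _ _ := rfl
  add_smul r s φ := ext fun a =>
    (congrArg φ (add_smul (op r) (op s) a)).trans (map_add φ _ _)
  zero_smul φ := ext fun a => (congrArg φ (zero_smul Sᵐᵒᵖ a)).trans (map_zero φ)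

@[simp] theorem smul_apply (r : S) (φ : RightDual A) (a : A) : (r • φ) a = φ (op r • a) := rfl

/-- The dual of a linear map of right modules. -/
def map (f : A →ₗ[Sᵐᵒᵖ] B) : RightDual B →ₗ[S] RightDual A where
  toFun φ := AddMonoidHom.comp (show B →+ AddCircle (1 : ℚ) from φ) f.toAddMonoidHom
  map_add' _ _ := rfl
  map_smul' r φ := ext fun a => congrArg φ (f.map_smul (op r) a).symm

@[simp] theorem map_apply (f : A →ₗ[Sᵐᵒᵖ] B) (φ : RightDual B) (a : A) :
    map f φ a = φ (f a) := rfl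

end RightDual

namespace LeftDual

variable {S : Type u} [Ring S] {M N : Type u} [AddCommGroup M] [Module S M]
  [AddCommGroup N] [Module S N]

instance : AddCommGroup (LeftDual M) := inferInstanceAs (AddCommGroup (M →+ AddCircle (1 : ℚ)))

instance : FunLike (LeftDual M) M (AddCircle (1 : ℚ)) :=
  inferInstanceAs (FunLike (M →+ AddCircle (1 : ℚ)) M _)

instance : AddMonoidHomClass (LeftDual M) M (AddCircle (1 : ℚ)) :=
  inferInstanceAs (AddMonoidHomClass (M →+ AddCircle (1 : ℚ)) M _)

@[ext] theorem ext {φ ψ : LeftDual M} (h : ∀ a, φ a = ψ a) : φ = ψ := DFunLike.ext _ _ h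

@[simp] theorem add_apply (φ ψ : LeftDual M) (a : M) : (φ + ψ) a = φ a + ψ a := rfl

instance : Module Sᵐᵒᵖ (LeftDual M) where
  smul r φ := AddMonoidHom.comp (show M →+ AddCircle (1 : ℚ) from φ)
    (DistribSMul.toAddMonoidHom M (unop r))
  one_smul φ := ext fun a => congrArg φ (one_smul S a)
  mul_smul r s φ := ext fun a => congrArg φ (mul_smul (unop s) (unop r) a)
  smul_zero _ := rfl
  smul_add _ _ _ := rfl
  add_smul r s φ := ext fun a =>
    (congrArg φ (add_smul (unop r) (unop s) a)).trans (map_add φ _ _)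
  zero_smul φ := ext fun a => (congrArg φ (zero_smul S a)).trans (map_zero φ)

@[simp] theorem smul_apply (r : Sᵐᵒᵖ) (φ : LeftDual M) (m : M) : (r • φ) m = φ (unop r • m) := rfl

/-- The dual of a linear map of left modules. -/
def map (f : M →ₗ[S] N) : LeftDual N →ₗ[Sᵐᵒᵖ] LeftDual M where
  toFun φ := AddMonoidHom.comp (show N →+ AddCircle (1 : ℚ) from φ) f.toAddMonoidHom
  map_add' _ _ := rfl
  map_smul' r φ := ext fun a => congrArg φ (f.map_smul (unop r) a).symm

@[simp] theorem map_apply (f : M →ₗ[S] N) (φ : LeftDual N) (a : M) :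
    map f φ a = φ (f a) := rfl

end LeftDual

/-- A character of a subgroup of an abelian group extends to the whole group. -/
theorem exists_character_extension {X Y : Type u} [AddCommGroup X] [AddCommGroup Y]
    (f : X →+ Y) (hf : Function.Injective f) (c : X →+ AddCircle (1 : ℚ)) :
    ∃ c' : Y →+ AddCircle (1 : ℚ), c'.comp f = c :=
  (Module.Baer.of_divisible _).extension_property_addMonoidHom f hf c

/-- A character that vanishes on the kernel of `g` factors through `g`. -/
theorem exists_character_factor {X Y : Type u} [AddCommGroup X] [AddCommGroup Y]
    (g : X →+ Y) (c : X →+ AddCircle (1 : ℚ)) (hc : ∀ x, g x = 0 → c x = 0) :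
    ∃ c' : Y →+ AddCircle (1 : ℚ), c'.comp g = c := by
  obtain ⟨c', hc'⟩ := exists_character_extension (QuotientAddGroup.kerLift g)
    (QuotientAddGroup.kerLift_injective g) (QuotientAddGroup.lift g.ker c fun x hx => hc x hx)
  refine ⟨c', AddMonoidHom.ext fun x => ?_⟩
  exact DFunLike.congr_fun hc' (QuotientAddGroup.mk x)

/-- Characters separate points from subgroups. -/
theorem exists_character_separating {X : Type u} [AddCommGroup X] (H : AddSubgroup X) {x : X}
    (hx : x ∉ H) : ∃ c : X →+ AddCircle (1 : ℚ), (∀ y ∈ H, c y = 0) ∧ c x ≠ 0 := by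
  have hne : (QuotientAddGroup.mk x : X ⧸ H) ≠ 0 := fun h =>
    hx ((QuotientAddGroup.eq_zero_iff x).1 h)
  obtain ⟨c, hc⟩ := CharacterModule.exists_character_apply_ne_zero_of_ne_zero hne
  refine ⟨AddMonoidHom.comp (show X ⧸ H →+ AddCircle (1 : ℚ) from c) (QuotientAddGroup.mk' H),
    fun y hy => ?_, hc⟩
  have : (QuotientAddGroup.mk y : X ⧸ H) = 0 := (QuotientAddGroup.eq_zero_iff y).2 hy
  exact (congrArg c this).trans (map_zero c)

variable {S : Type u} [Ring S]

section Adjunction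

variable {A B : Type u} [AddCommGroup A] [Module Sᵐᵒᵖ A] [AddCommGroup B] [Module Sᵐᵒᵖ B]
variable {M N : Type u} [AddCommGroup M] [Module S M] [AddCommGroup N] [Module S N]

/-- The transpose `A → M⁺` of a linear map `M → A⁺`. -/
def RightDual.transpose (φ : M →ₗ[S] RightDual A) : A →ₗ[Sᵐᵒᵖ] LeftDual M where
  toFun a :=
    { toFun := fun m => φ m a
      map_zero' := by simp
      map_add' := by simp }
  map_add' a b := LeftDual.ext fun m => map_add (φ m) a b
  map_smul' r a := LeftDual.ext fun m => by
    change φ m (r • a) = φ (unop r • m) a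
    rw [φ.map_smul]; rfl

@[simp] theorem RightDual.transpose_apply (φ : M →ₗ[S] RightDual A) (a : A) (m : M) :
    RightDual.transpose φ a m = φ m a := rfl

/-- The transpose `M → A⁺` of a linear map `A → M⁺`. -/
def LeftDual.transpose (ψ : A →ₗ[Sᵐᵒᵖ] LeftDual M) : M →ₗ[S] RightDual A where
  toFun m :=
    { toFun := fun a => ψ a m
      map_zero' := by rw [map_zero]; rfl
      map_add' := by simp }
  map_add' a b := RightDual.ext fun m => map_add (ψ m) a b
  map_smul' r m := RightDual.ext fun a => by
    change ψ a (r • m) = ψ (op r • a) m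
    rw [ψ.map_smul]; rfl

@[simp] theorem LeftDual.transpose_apply (ψ : A →ₗ[Sᵐᵒᵖ] LeftDual M) (a : A) (m : M) :
    LeftDual.transpose ψ m a = ψ a m := rfl

namespace NTensor

/-- The elementary tensor `a ⊗ m`. -/
def tmul (S : Type u) [Ring S] {A M : Type u} [AddCommGroup A] [Module Sᵐᵒᵖ A]
    [AddCommGroup M] [Module S M] (a : A) (m : M) : NTensor S A M :=
  QuotientAddGroup.mk (FreeAbelianGroup.of (a, m))

@[simp] theorem rmap_tmul (g : M →ₗ[S] N) (a : A) (m : M) :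
    rmap A g (tmul S a m) = tmul S a (g m) := by
  change QuotientAddGroup.mk (FreeAbelianGroup.map _ (FreeAbelianGroup.of (a, m))) = _
  rw [FreeAbelianGroup.map_of_apply]; rfl

@[simp] theorem lmap_tmul (f : A →ₗ[Sᵐᵒᵖ] B) (a : A) (m : M) :
    lmap M f (tmul S a m) = tmul S (f a) m := by
  change QuotientAddGroup.mk (FreeAbelianGroup.map _ (FreeAbelianGroup.of (a, m))) = _
  rw [FreeAbelianGroup.map_of_apply]; rfl

theorem hom_ext {G : Type*} [AddCommGroup G] {f g : NTensor S A M →+ G}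
    (h : ∀ a m, f (tmul S a m) = g (tmul S a m)) : f = g :=
  QuotientAddGroup.addMonoidHom_ext _ (FreeAbelianGroup.lift_ext _ _ fun p => h p.1 p.2)

theorem add_tmul (a b : A) (m : M) : tmul S (a + b) m = tmul S a m + tmul S b m := by
  rw [← sub_eq_zero, ← sub_sub]
  exact (QuotientAddGroup.eq_zero_iff _).2
    (AddSubgroup.subset_closure (Or.inl ⟨a, b, m, rfl⟩))

theorem tmul_add (a : A) (m n : M) : tmul S a (m + n) = tmul S a m + tmul S a n := by
  rw [← sub_eq_zero, ← sub_sub]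
  exact (QuotientAddGroup.eq_zero_iff _).2
    (AddSubgroup.subset_closure (Or.inr (Or.inl ⟨a, m, n, rfl⟩)))

theorem smul_tmul (a : A) (r : S) (m : M) : tmul S (op r • a) m = tmul S a (r • m) := by
  rw [← sub_eq_zero]
  exact (QuotientAddGroup.eq_zero_iff _).2
    (AddSubgroup.subset_closure (Or.inr (Or.inr ⟨a, r, m, rfl⟩)))

/-- The character of `A ⊗ M` associated with a linear map `M → A⁺`. -/
def toChar (φ : M →ₗ[S] RightDual A) : NTensor S A M →+ AddCircle (1 : ℚ) :=
  QuotientAddGroup.lift _ (FreeAbelianGroup.lift fun p => φ p.2 p.1) (by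
    simp only [tensorRels]
    refine (AddSubgroup.closure_le _).2 ?_
    rintro x (⟨a₁, a₂, m, rfl⟩ | ⟨a, m₁, m₂, rfl⟩ | ⟨a, r, m, rfl⟩) <;>
      simp)

@[simp] theorem toChar_tmul (φ : M →ₗ[S] RightDual A) (a : A) (m : M) :
    toChar φ (tmul S a m) = φ m a :=
  FreeAbelianGroup.lift_apply_of _ _

/-- The linear map `M → A⁺` associated with a character of `A ⊗ M`. -/
def ofChar (c : NTensor S A M →+ AddCircle (1 : ℚ)) : M →ₗ[S] RightDual A where
  toFun m := AddMonoidHom.mk' (fun a => c (tmul S a m)) fun a b => by rw [add_tmul, map_add]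
  map_add' m n := RightDual.ext fun a => (congrArg c (tmul_add a m n)).trans (map_add c _ _)
  map_smul' r m := RightDual.ext fun a => (congrArg c (smul_tmul a r m)).symm

@[simp] theorem ofChar_apply (c : NTensor S A M →+ AddCircle (1 : ℚ)) (a : A) (m : M) :
    ofChar c m a = c (tmul S a m) := rfl

@[simp] theorem toChar_ofChar (c : NTensor S A M →+ AddCircle (1 : ℚ)) :
    toChar (ofChar c) = c :=
  hom_ext fun a m => by simp

/-- Exactness of `A ⊗ −` at `N` is dual to exactness of `Hom(−, A⁺)` at `N`. -/
theorem exact_rmap_iff {L : Type u} [AddCommGroup L] [Module S L] {f : M →ₗ[S] N} {g : N →ₗ[S] L}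
    (hgf : ∀ x, g (f x) = 0) :
    Function.Exact (rmap A f) (rmap A g) ↔
      ∀ φ : N →ₗ[S] RightDual A, (∀ x, φ (f x) = 0) →
        ∃ ψ : L →ₗ[S] RightDual A, ∀ y, ψ (g y) = φ y := by
  constructor
  · intro h φ hφ
    have h0 : (toChar φ).comp (rmap A f) = 0 := hom_ext fun a m => by simp [hφ]
    obtain ⟨c, hc⟩ := exists_character_factor (rmap A g) (toChar φ) fun x hx => by
      obtain ⟨y, rfl⟩ := (h x).1 hx
      exact DFunLike.congr_fun h0 y
    refine ⟨ofChar c, fun y => RightDual.ext fun a => ?_⟩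
    have := DFunLike.congr_fun hc (tmul S a y)
    simpa using this
  · intro h x
    constructor
    · intro hx
      by_contra hn
      obtain ⟨c, hc, hcx⟩ := exists_character_separating (rmap A f).range (x := x) hn
      obtain ⟨ψ, hψ⟩ := h (ofChar c) fun m => RightDual.ext fun a => by
        simpa using hc _ ⟨tmul S a m, rfl⟩
      have : c = (toChar ψ).comp (rmap A g) := hom_ext fun a m => by simp [hψ]
      rw [this, AddMonoidHom.comp_apply, hx, map_zero] at hcx
      exact hcx rfl
    · rintro ⟨y, rfl⟩
      have : (rmap A g).comp (rmap A f) = 0 := hom_ext fun a m => by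
        have h0 : tmul S a (0 : L) = 0 := by
          have := tmul_add (S := S) a (0 : L) 0
          simpa using this
        simp [hgf, h0]
      exact DFunLike.congr_fun this y

end NTensor

end Adjunction

/-- A module is flat if and only if its character module is injective. -/
theorem isFlatMod_iff_injective_leftDual (M : ModuleCat.{u} S) :
    IsFlatMod S M ↔ Module.Injective Sᵐᵒᵖ (LeftDual M) := by
  constructor
  · refine fun h => ⟨fun A B _ _ _ _ f hf g => ?_⟩
    obtain ⟨c, hc⟩ := exists_character_extension _ (h A B f hf)
      (NTensor.toChar (LeftDual.transpose g))
    refine ⟨RightDual.transpose (NTensor.ofChar c), fun a => LeftDual.ext fun m => ?_⟩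
    have := DFunLike.congr_fun hc (NTensor.tmul S a m)
    simpa using this
  · intro h A B _ _ _ _ f hf
    refine (injective_iff_map_eq_zero _).2 fun x hx => ?_
    refine CharacterModule.eq_zero_of_character_apply fun c => ?_
    let c' : NTensor S A M →+ AddCircle (1 : ℚ) := c
    obtain ⟨ψ, hψ⟩ := h.out f hf (RightDual.transpose (NTensor.ofChar c'))
    have : c' = (NTensor.toChar (LeftDual.transpose ψ)).comp (NTensor.lmap M f) :=
      NTensor.hom_ext fun a m => by simp [hψ]
    change c' x = 0
    rw [this, AddMonoidHom.comp_apply, hx, map_zero]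

/-- The character module of a projective right module is injective. -/
theorem injective_rightDual_of_projective (Q : Type u) [AddCommGroup Q] [Module Sᵐᵒᵖ Q]
    [Module.Projective Sᵐᵒᵖ Q] : Module.Injective S (RightDual Q) := by
  refine ⟨fun X Y _ _ _ _ f hf g => ?_⟩
  have hs : Function.Surjective (LeftDual.map f) := fun c =>
    exists_character_extension f.toAddMonoidHom hf c
  obtain ⟨h, hh⟩ := Module.projective_lifting_property (LeftDual.map f)
    (RightDual.transpose g) hs
  refine ⟨LeftDual.transpose h, fun x => RightDual.ext fun q => ?_⟩
  have := DFunLike.congr_fun (DFunLike.congr_fun hh q) x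
  simpa using this

end Duality

section ShortExactSequences

open CategoryTheory Abelian

variable {S : Type u} [Ring S]

/-- `0 → K → G → M → 0` is a short exact sequence of modules. -/
structure IsShortExact {K G M : Type*} [AddCommGroup K] [Module S K] [AddCommGroup G] [Module S G]
    [AddCommGroup M] [Module S M] (ι : K →ₗ[S] G) (π : G →ₗ[S] M) : Prop where
  inj : Function.Injective ι
  surj : Function.Surjective π
  exact : Function.Exact ι π

namespace IsShortExact

variable {K G M : ModuleCat.{u} S} {ι : K →ₗ[S] G} {π : G →ₗ[S] M}

/-- The short complex in the category of modules attached to a short exact sequence. -/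
abbrev toShortComplex (h : IsShortExact ι π) : ShortComplex (ModuleCat.{u} S) :=
  ShortComplex.mk (ModuleCat.ofHom ι) (ModuleCat.ofHom π)
    (ModuleCat.hom_ext (LinearMap.ext h.exact.apply_apply_eq_zero))

theorem shortExact (h : IsShortExact ι π) : h.toShortComplex.ShortExact :=
  ModuleCat.shortComplex_shortExact _ h.exact h.inj h.surj

theorem ext_right (h : IsShortExact ι π) {Y : ModuleCat.{u} S} {i : ℕ}
    (h₁ : Subsingleton (Ext K Y i)) (h₂ : Subsingleton (Ext G Y (i + 1))) :
    Subsingleton (Ext M Y (i + 1)) := by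
  refine subsingleton_of_forall_eq 0 fun x => ?_
  obtain ⟨y, rfl⟩ := Ext.contravariant_sequence_exact₃ h.shortExact Y x
    (Subsingleton.elim (α := Ext G Y (i + 1)) _ _) (add_comm 1 i)
  rw [show y = 0 from Subsingleton.elim (α := Ext K Y i) _ _, Ext.comp_zero]

theorem ext_left (h : IsShortExact ι π) {Y : ModuleCat.{u} S} {i : ℕ}
    (h₂ : Subsingleton (Ext G Y i)) (h₃ : Subsingleton (Ext M Y (i + 1))) :
    Subsingleton (Ext K Y i) := by
  refine subsingleton_of_forall_eq 0 fun x => ?_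
  obtain ⟨y, rfl⟩ := Ext.contravariant_sequence_exact₁ h.shortExact Y x (add_comm 1 i)
    (Subsingleton.elim (α := Ext M Y (i + 1)) _ _)
  rw [show y = 0 from Subsingleton.elim (α := Ext G Y i) _ _, Ext.comp_zero]

theorem ext_middle (h : IsShortExact ι π) {Y : ModuleCat.{u} S} {i : ℕ}
    (h₁ : Subsingleton (Ext K Y i)) (h₃ : Subsingleton (Ext M Y i)) :
    Subsingleton (Ext G Y i) := by
  refine subsingleton_of_forall_eq 0 fun x => ?_
  obtain ⟨y, rfl⟩ := Ext.contravariant_sequence_exact₂ h.shortExact Y x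
    (Subsingleton.elim (α := Ext K Y i) _ _)
  rw [show y = 0 from Subsingleton.elim (α := Ext M Y i) _ _, Ext.comp_zero]

theorem ext_left_covariant (h : IsShortExact ι π) {X : ModuleCat.{u} S} {i : ℕ}
    (h₂ : Subsingleton (Ext X G (i + 1))) (h₃ : Subsingleton (Ext X M i)) :
    Subsingleton (Ext X K (i + 1)) := by
  refine subsingleton_of_forall_eq 0 fun x => ?_
  obtain ⟨y, rfl⟩ := Ext.covariant_sequence_exact₁ X h.shortExact x
    (Subsingleton.elim (α := Ext X G (i + 1)) _ _) rfl
  rw [show y = 0 from Subsingleton.elim (α := Ext X M i) _ _, Ext.zero_comp]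

theorem ext_right_covariant (h : IsShortExact ι π) {X : ModuleCat.{u} S} {i : ℕ}
    (h₁ : Subsingleton (Ext X K (i + 1))) (h₂ : Subsingleton (Ext X G i)) :
    Subsingleton (Ext X M i) := by
  refine subsingleton_of_forall_eq 0 fun x => ?_
  obtain ⟨y, rfl⟩ := Ext.covariant_sequence_exact₃ X h.shortExact x rfl
    (Subsingleton.elim (α := Ext X K (i + 1)) _ _)
  rw [show y = 0 from Subsingleton.elim (α := Ext X G i) _ _, Ext.zero_comp]

theorem ext_one_right_iff (h : IsShortExact ι π) {Y : ModuleCat.{u} S}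
    (hG : Subsingleton (Ext G Y 1)) :
    Subsingleton (Ext M Y 1) ↔ ∀ φ : K →ₗ[S] Y, ∃ ψ : G →ₗ[S] Y, ∀ x, ψ (ι x) = φ x := by
  constructor
  · intro hM φ
    obtain ⟨y, hy⟩ := Ext.contravariant_sequence_exact₁ h.shortExact Y
      (Ext.mk₀ (ModuleCat.ofHom φ)) (add_zero 1) (Subsingleton.elim (α := Ext M Y 1) _ _)
    obtain ⟨g, rfl⟩ := (Ext.mk₀_bijective _ _).2 y
    rw [Ext.mk₀_comp_mk₀] at hy
    have := (Ext.mk₀_bijective _ _).1 hy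
    exact ⟨g.hom, fun x => LinearMap.congr_fun (congrArg ModuleCat.Hom.hom this) x⟩
  · intro H
    refine subsingleton_of_forall_eq 0 fun x => ?_
    obtain ⟨y, rfl⟩ := Ext.contravariant_sequence_exact₃ h.shortExact Y x
      (Subsingleton.elim (α := Ext G Y 1) _ _) (add_zero 1)
    obtain ⟨f, rfl⟩ := (Ext.mk₀_bijective _ _).2 y
    obtain ⟨ψ, hψ⟩ := H f.hom
    have : f = h.toShortComplex.f ≫ ModuleCat.ofHom ψ :=
      ModuleCat.hom_ext (LinearMap.ext fun x => (hψ x).symm)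
    rw [this, ← Ext.mk₀_comp_mk₀]
    exact h.shortExact.extClass_comp_assoc _

theorem ext_one_left_iff (h : IsShortExact ι π) {X : ModuleCat.{u} S}
    (hG : Subsingleton (Ext X G 1)) :
    Subsingleton (Ext X K 1) ↔ ∀ φ : X →ₗ[S] M, ∃ ψ : X →ₗ[S] G, ∀ x, π (ψ x) = φ x := by
  constructor
  · intro hM φ
    obtain ⟨y, hy⟩ := Ext.covariant_sequence_exact₃ X h.shortExact
      (Ext.mk₀ (ModuleCat.ofHom φ)) (zero_add 1) (Subsingleton.elim (α := Ext X K 1) _ _)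
    obtain ⟨g, rfl⟩ := (Ext.mk₀_bijective _ _).2 y
    rw [Ext.mk₀_comp_mk₀] at hy
    have := (Ext.mk₀_bijective _ _).1 hy
    exact ⟨g.hom, fun x => LinearMap.congr_fun (congrArg ModuleCat.Hom.hom this) x⟩
  · intro H
    refine subsingleton_of_forall_eq 0 fun x => ?_
    obtain ⟨y, rfl⟩ := Ext.covariant_sequence_exact₁ X h.shortExact x
      (Subsingleton.elim (α := Ext X G 1) _ _) (zero_add 1)
    obtain ⟨f, rfl⟩ := (Ext.mk₀_bijective _ _).2 y
    obtain ⟨ψ, hψ⟩ := H f.hom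
    have : f = ModuleCat.ofHom ψ ≫ h.toShortComplex.g :=
      ModuleCat.hom_ext (LinearMap.ext fun x => (hψ x).symm)
    rw [this, ← Ext.mk₀_comp_mk₀, Ext.comp_assoc_of_second_deg_zero,
      ShortComplex.ShortExact.comp_extClass, Ext.comp_zero]

end IsShortExact

theorem subsingleton_ext_of_iso {M M' Y Y' : ModuleCat.{u} S} (e : M ≅ M')
    (e' : Y ≅ Y') {i : ℕ} (h : Subsingleton (Ext M Y i)) : Subsingleton (Ext M' Y' i) := by
  refine subsingleton_of_forall_eq 0 fun x => ?_
  have h0 : ((Ext.mk₀ e.hom).comp x (zero_add i)).comp (Ext.mk₀ e'.inv) (add_zero i) = 0 :=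
    Subsingleton.elim (α := Ext M Y i) _ _
  have h1 := congrArg (fun y => ((Ext.mk₀ e.inv).comp y (zero_add i)).comp
      (Ext.mk₀ e'.hom) (add_zero i)) h0
  simpa using h1

/-- Every module is the quotient of a projective module. -/
theorem exists_projective_cover (M : ModuleCat.{u} S) :
    ∃ (K P : ModuleCat.{u} S) (ι : K →ₗ[S] P) (π : P →ₗ[S] M),
      IsShortExact ι π ∧ Module.Projective S P := by
  let π : (M →₀ S) →ₗ[S] M := Finsupp.linearCombination S id
  refine ⟨ModuleCat.of S (LinearMap.ker π), ModuleCat.of S (M →₀ S),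
    (LinearMap.ker π).subtype, π, ⟨Subtype.val_injective, ?_, ?_⟩, ?_⟩
  · exact Finsupp.linearCombination_id_surjective S M
  · exact LinearMap.exact_subtype_ker_map π
  · exact inferInstanceAs (Module.Projective S (M →₀ S))

/-- Every module embeds into an injective module. -/
theorem exists_injective_hull (M : ModuleCat.{u} S) :
    ∃ (I C : ModuleCat.{u} S) (ι : M →ₗ[S] I) (π : I →ₗ[S] C),
      IsShortExact ι π ∧ Module.Injective S I := by
  have : EnoughInjectives (ModuleCat.{u} S) := ModuleCat.enoughInjectives.{u, u} S
  let I := Injective.under M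
  let ι := (Injective.ι M).hom
  refine ⟨I, ModuleCat.of S (I ⧸ LinearMap.range ι), ι, (LinearMap.range ι).mkQ, ⟨?_, ?_, ?_⟩, ?_⟩
  · exact (ModuleCat.mono_iff_injective _).1 inferInstance
  · exact Submodule.mkQ_surjective _
  · exact LinearMap.exact_map_mkQ_range ι
  · have : Injective (ModuleCat.of S I) := inferInstanceAs (Injective (Injective.under M))
    exact Module.injective_module_of_injective_object S I

theorem subsingleton_ext_of_projective {P Y : ModuleCat.{u} S} (hP : Module.Projective S P)
    {i : ℕ} : Subsingleton (Ext P Y (i + 1)) := by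
  have : Projective P := (IsProjective.iff_projective (R := S) P).1 hP
  exact Ext.subsingleton_of_projective P Y i

theorem subsingleton_ext_of_injective {X I : ModuleCat.{u} S} (hI : Module.Injective S I)
    {i : ℕ} : Subsingleton (Ext X I (i + 1)) := by
  have : Injective I := Module.injective_object_of_injective_module S I
  exact Ext.subsingleton_of_injective X I i

theorem injective_of_subsingleton_ext_one {I : ModuleCat.{u} S}
    (h : ∀ X : ModuleCat.{u} S, Subsingleton (Ext X I 1)) : Module.Injective S I := by
  have : Injective (ModuleCat.of S I) := injective_iff_subsingleton_ext_one.2 fun {X} => h X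
  exact Module.injective_module_of_injective_object S I

end ShortExactSequences

section TorVanishing

open CategoryTheory Abelian

variable {S : Type u} [Ring S]

/-- The vanishing of `Tor_i(A, M)`, expressed through its character group `Ext^i(M, A⁺)`. -/
def TorZero (A : ModuleCat.{u} Sᵐᵒᵖ) (M : ModuleCat.{u} S) (i : ℕ) : Prop :=
  Subsingleton (Ext M (ModuleCat.of S (RightDual A)) i)

theorem IsShortExact.rightDual {A B C : ModuleCat.{u} Sᵐᵒᵖ} {f : A →ₗ[Sᵐᵒᵖ] B}
    {g : B →ₗ[Sᵐᵒᵖ] C} (h : IsShortExact f g) :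
    IsShortExact (RightDual.map g) (RightDual.map f) where
  inj := fun φ ψ hφψ => RightDual.ext fun c => by
    obtain ⟨b, rfl⟩ := h.surj c
    exact DFunLike.congr_fun hφψ b
  surj := fun c => exists_character_extension f.toAddMonoidHom h.inj c
  exact := fun φ => by
    constructor
    · intro hφ
      exact exists_character_factor g.toAddMonoidHom φ fun b hb => by
        obtain ⟨a, rfl⟩ := (h.exact b).1 hb
        exact DFunLike.congr_fun hφ a
    · rintro ⟨ψ, rfl⟩
      refine RightDual.ext fun a => ?_
      simp [h.exact.apply_apply_eq_zero]

/-- `Tor` is balanced: its vanishing can be tested on either variable. -/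
theorem torZero_iff_ext_leftDual (i : ℕ) (A : ModuleCat.{u} Sᵐᵒᵖ) (M : ModuleCat.{u} S) :
    TorZero A M (i + 1) ↔ Subsingleton (Ext A (ModuleCat.of Sᵐᵒᵖ (LeftDual M)) (i + 1)) := by
  induction i generalizing A with
  | zero =>
    obtain ⟨B, Q, f, g, h, hQ⟩ := exists_projective_cover A
    have hQ' : Module.Injective S (ModuleCat.of S (RightDual Q)) :=
      injective_rightDual_of_projective Q
    refine (IsShortExact.ext_one_left_iff (K := ModuleCat.of S (RightDual A))
      (G := ModuleCat.of S (RightDual Q)) (M := ModuleCat.of S (RightDual B)) h.rightDual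
      (subsingleton_ext_of_injective hQ')).trans
      (Iff.trans ?_ (h.ext_one_right_iff (subsingleton_ext_of_projective hQ)).symm)
    constructor
    · intro H φ
      obtain ⟨ψ, hψ⟩ := H (LeftDual.transpose φ)
      refine ⟨RightDual.transpose ψ, fun x => LeftDual.ext fun m => ?_⟩
      exact DFunLike.congr_fun (hψ m) x
    · intro H φ
      obtain ⟨ψ, hψ⟩ := H (RightDual.transpose φ)
      refine ⟨LeftDual.transpose ψ, fun m => RightDual.ext fun x => ?_⟩
      exact DFunLike.congr_fun (hψ x) m
  | succ i ih =>
    obtain ⟨B, Q, f, g, h, hQ⟩ := exists_projective_cover A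
    have hQ' : Module.Injective S (ModuleCat.of S (RightDual Q)) :=
      injective_rightDual_of_projective Q
    have hd : IsShortExact (K := ModuleCat.of S (RightDual A))
      (G := ModuleCat.of S (RightDual Q)) (M := ModuleCat.of S (RightDual B)) _ _ := h.rightDual
    refine Iff.trans ⟨fun H => ?_, fun H => ?_⟩ ((ih B).trans ⟨fun H => ?_, fun H => ?_⟩)
    · exact hd.ext_right_covariant H (subsingleton_ext_of_injective hQ')
    · exact hd.ext_left_covariant (subsingleton_ext_of_injective hQ') H
    · exact h.ext_right H (subsingleton_ext_of_projective hQ)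
    · exact h.ext_left (subsingleton_ext_of_projective hQ) H

theorem IsFlatMod.torZero {M : ModuleCat.{u} S} (hM : IsFlatMod S M) (A : ModuleCat.{u} Sᵐᵒᵖ)
    (i : ℕ) : TorZero A M (i + 1) :=
  (torZero_iff_ext_leftDual i A M).2
    (subsingleton_ext_of_injective ((isFlatMod_iff_injective_leftDual M).1 hM))

theorem isFlatMod_of_torZero_one {M : ModuleCat.{u} S}
    (h : ∀ A : ModuleCat.{u} Sᵐᵒᵖ, TorZero A M 1) : IsFlatMod S M :=
  (isFlatMod_iff_injective_leftDual M).2 (injective_of_subsingleton_ext_one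
    (I := ModuleCat.of Sᵐᵒᵖ (LeftDual M)) fun A => (torZero_iff_ext_leftDual 0 A M).1 (h A))

theorem isFlatMod_of_projective {P : ModuleCat.{u} S} (hP : Module.Projective S P) :
    IsFlatMod S P :=
  isFlatMod_of_torZero_one fun _ => subsingleton_ext_of_projective hP

/-- `Tor` of a submodule in the first variable vanishes if the adjacent terms of the long exact
sequence do. -/
theorem IsShortExact.torZero_left {A B C : ModuleCat.{u} Sᵐᵒᵖ} {f : A →ₗ[Sᵐᵒᵖ] B}
    {g : B →ₗ[Sᵐᵒᵖ] C} (h : IsShortExact f g) {M : ModuleCat.{u} S} {i : ℕ}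
    (hB : TorZero B M i) (hC : TorZero C M (i + 1)) : TorZero A M i :=
  IsShortExact.ext_right_covariant (K := ModuleCat.of S (RightDual C))
    (G := ModuleCat.of S (RightDual B)) (M := ModuleCat.of S (RightDual A)) h.rightDual hC hB

variable (S) in
/-- `Tor_i(I, M) = 0` for all injective right modules `I`, all left modules `M` and all `i > n`. -/
def RightInjTorZero (n : ℕ) : Prop :=
  ∀ (I : ModuleCat.{u} Sᵐᵒᵖ), Module.Injective Sᵐᵒᵖ I → ∀ (M : ModuleCat.{u} S) (i : ℕ),
    n ≤ i → TorZero I M (i + 1)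

variable (S) in
/-- `Tor_i(A, E) = 0` for all injective left modules `E`, all right modules `A` and all `i > n`. -/
def LeftInjTorZero (n : ℕ) : Prop :=
  ∀ (E : ModuleCat.{u} S), Module.Injective S E → ∀ (A : ModuleCat.{u} Sᵐᵒᵖ) (i : ℕ),
    n ≤ i → TorZero A E (i + 1)

theorem LeftInjTorZero.of_rightInjTorZero {m n : ℕ} (hl : LeftInjTorZero S m)
    (hr : RightInjTorZero S n) : LeftInjTorZero S n := by
  intro E hE A i hi
  suffices H : ∀ (k i : ℕ) (A : ModuleCat.{u} Sᵐᵒᵖ), n ≤ i → m ≤ i + k → TorZero A E (i + 1) from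
    H m i A hi (Nat.le_add_left m i)
  intro k
  induction k with
  | zero => exact fun i A _ h => hl E hE A i h
  | succ k ih =>
    intro i A hi h
    obtain ⟨I, C, f, g, hfg, hI⟩ := exists_injective_hull A
    exact hfg.torZero_left (hr I hI E i hi) (ih (i + 1) C (by omega) (by omega))

theorem RightInjTorZero.of_leftInjTorZero {m n : ℕ} (hr : RightInjTorZero S m)
    (hl : LeftInjTorZero S n) : RightInjTorZero S n := by
  intro I hI M i hi
  suffices H : ∀ (k i : ℕ) (M : ModuleCat.{u} S), n ≤ i → m ≤ i + k → TorZero I M (i + 1) from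
    H m i M hi (Nat.le_add_left m i)
  intro k
  induction k with
  | zero => exact fun i M _ h => hr I hI M i h
  | succ k ih =>
    intro i M hi h
    obtain ⟨E, C, f, g, hfg, hE⟩ := exists_injective_hull M
    exact hfg.ext_left (hl E hE I i hi) (ih (i + 1) C (by omega) (by omega))

theorem leftInjTorZero_iff_rightInjTorZero_op (n : ℕ) :
    LeftInjTorZero S n ↔ RightInjTorZero Sᵐᵒᵖ n := by
  constructor
  · intro h E hE A i hi
    let hmod : Module S E := Module.compHom E (RingEquiv.opOp S).toRingHom
    let e : (ModuleCat.of Sᵐᵒᵖ (LeftDual (ModuleCat.of S E))) ≃ₗ[Sᵐᵒᵖ]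
        (ModuleCat.of Sᵐᵒᵖ (RightDual E)) :=
      { AddEquiv.refl (CharacterModule E) with
        map_smul' := fun _ _ => rfl }
    have hinj : Module.Injective S (ModuleCat.of S E) := by
      refine ⟨fun X Y _ _ _ _ f hf g => ?_⟩
      let _ : Module Sᵐᵒᵖᵐᵒᵖ X := Module.compHom X (RingEquiv.opOp S).symm.toRingHom
      let _ : Module Sᵐᵒᵖᵐᵒᵖ Y := Module.compHom Y (RingEquiv.opOp S).symm.toRingHom
      let f' : X →ₗ[Sᵐᵒᵖᵐᵒᵖ] Y := { f with map_smul' := fun r x => f.map_smul (unop (unop r)) x }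
      let g' : X →ₗ[Sᵐᵒᵖᵐᵒᵖ] E := { g with map_smul' := fun r x => g.map_smul (unop (unop r)) x }
      obtain ⟨k, hk⟩ := hE.out f' hf g'
      exact ⟨{ k with map_smul' := fun r y => k.map_smul (op (op r)) y }, hk⟩
    exact subsingleton_ext_of_iso (Iso.refl A) e.toModuleIso
      ((torZero_iff_ext_leftDual i A (ModuleCat.of S E)).1 (h _ hinj A i hi))
  · intro h E hE A i hi
    let hmod : Module Sᵐᵒᵖᵐᵒᵖ E := Module.compHom E (RingEquiv.opOp S).symm.toRingHom
    let e : (ModuleCat.of Sᵐᵒᵖ (RightDual (ModuleCat.of Sᵐᵒᵖᵐᵒᵖ E))) ≃ₗ[Sᵐᵒᵖ]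
        (ModuleCat.of Sᵐᵒᵖ (LeftDual E)) :=
      { AddEquiv.refl (CharacterModule E) with
        map_smul' := fun _ _ => rfl }
    have hinj : Module.Injective Sᵐᵒᵖᵐᵒᵖ (ModuleCat.of Sᵐᵒᵖᵐᵒᵖ E) := by
      refine ⟨fun X Y _ _ _ _ f hf g => ?_⟩
      let _ : Module S X := Module.compHom X (RingEquiv.opOp S).toRingHom
      let _ : Module S Y := Module.compHom Y (RingEquiv.opOp S).toRingHom
      let f' : X →ₗ[S] Y := { f with map_smul' := fun r x => f.map_smul (op (op r)) x }
      let g' : X →ₗ[S] E := { g with map_smul' := fun r x => g.map_smul (op (op r)) x }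
      obtain ⟨k, hk⟩ := hE.out f' hf g'
      exact ⟨{ k with map_smul' := fun r y => k.map_smul (unop (unop r)) y }, hk⟩
    exact (torZero_iff_ext_leftDual i A E).2 (subsingleton_ext_of_iso (Iso.refl A) e.toModuleIso
      (h _ hinj A i hi))

end TorVanishing

section GorensteinFlat

open CategoryTheory Abelian

variable {S : Type u} [Ring S]

/-- `Tor_i(I, M) = 0` for all injective right modules `I` and all `i > 0`. -/
def TorVanishes (M : ModuleCat.{u} S) : Prop :=
  ∀ I : ModuleCat.{u} Sᵐᵒᵖ, Module.Injective Sᵐᵒᵖ I → ∀ i : ℕ, TorZero I M (i + 1)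

/-- There is a short exact sequence `0 → A → F → B → 0` with `F` flat. -/
def FlatStep (A B : ModuleCat.{u} S) : Prop :=
  ∃ (F : ModuleCat.{u} S) (ι : A →ₗ[S] F) (π : F →ₗ[S] B), IsFlatMod S F ∧ IsShortExact ι π

theorem TorVanishes.of_equiv {M N : ModuleCat.{u} S} (e : M ≃ₗ[S] N) (h : TorVanishes M) :
    TorVanishes N := fun I hI i =>
  subsingleton_ext_of_iso e.toModuleIso (Iso.refl _) (h I hI i)

theorem IsFlatMod.torVanishes {M : ModuleCat.{u} S} (h : IsFlatMod S M) : TorVanishes M :=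
  fun I _ i => h.torZero I i

theorem IsShortExact.torVanishes_left {K G M : ModuleCat.{u} S} {ι : K →ₗ[S] G} {π : G →ₗ[S] M}
    (h : IsShortExact ι π) (hG : TorVanishes G) (hM : TorVanishes M) : TorVanishes K :=
  fun I hI i => h.ext_left (hG I hI i) (hM I hI (i + 1))

theorem FlatStep.of_equiv_left {A A' B : ModuleCat.{u} S} (e : A' ≃ₗ[S] A) (h : FlatStep A B) :
    FlatStep A' B := by
  obtain ⟨F, ι, π, hF, h⟩ := h
  refine ⟨F, ι.comp e.toLinearMap, π, hF, h.inj.comp e.injective, h.surj, fun y => ?_⟩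
  rw [h.exact y]
  constructor
  · rintro ⟨x, rfl⟩
    exact ⟨e.symm x, by simp⟩
  · rintro ⟨x, rfl⟩
    exact ⟨e x, rfl⟩

/-- The short exact sequence `0 → Im f → Y → Im g → 0` cut out of an exact sequence. -/
theorem isShortExact_range {X Y Z : Type*} [AddCommGroup X] [Module S X] [AddCommGroup Y]
    [Module S Y] [AddCommGroup Z] [Module S Z] {f : X →ₗ[S] Y} {g : Y →ₗ[S] Z}
    (h : Function.Exact f g) : IsShortExact (LinearMap.range f).subtype g.rangeRestrict where
  inj := Subtype.val_injective
  surj := g.surjective_rangeRestrict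
  exact := fun y => by
    constructor
    · intro hy
      exact ⟨⟨y, (h y).1 (congrArg Subtype.val hy)⟩, rfl⟩
    · rintro ⟨⟨_, x, rfl⟩, rfl⟩
      exact Subtype.ext (h.apply_apply_eq_zero x)

/-- A linear map vanishing on the kernel of a surjection factors through it. -/
theorem exists_linearMap_factor {X Y Z : Type*} [AddCommGroup X] [Module S X] [AddCommGroup Y]
    [Module S Y] [AddCommGroup Z] [Module S Z] {f : X →ₗ[S] Y} (hf : Function.Surjective f)
    (g : X →ₗ[S] Z) (h : ∀ x, f x = 0 → g x = 0) : ∃ k : Y →ₗ[S] Z, ∀ x, k (f x) = g x := by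
  refine ⟨((LinearMap.ker f).liftQ g h).comp (f.quotKerEquivOfSurjective hf).symm.toLinearMap,
    fun x => ?_⟩
  rw [LinearMap.comp_apply, LinearEquiv.coe_coe,
    show (f.quotKerEquivOfSurjective hf).symm (f x) = Submodule.Quotient.mk x from
      (LinearEquiv.symm_apply_eq _).2 rfl]
  rfl

/-- The images in a complete flat resolution. -/
theorem IsGorensteinFlat.exists_sequence {M : ModuleCat.{u} S} (hM : IsGorensteinFlat S M) :
    ∃ N : ℤ → ModuleCat.{u} S, Nonempty (M ≃ₗ[S] N 0) ∧
      ∀ n, FlatStep (N n) (N (n + 1)) ∧ TorVanishes (N n) := by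
  obtain ⟨F, d, hF, hd, hM, hI⟩ := hM
  let N : ℤ → ModuleCat.{u} S := fun n => ModuleCat.of S (LinearMap.range (d n))
  have hN (n : ℤ) : IsShortExact (K := N n) (G := F (n + 1)) (M := N (n + 1)) _ _ :=
    isShortExact_range (hd n)
  refine ⟨N, hM, fun n => ⟨⟨F (n + 1), _, _, hF _, hN n⟩, fun I hinj i => ?_⟩⟩
  induction i generalizing n with
  | zero =>
    obtain ⟨m, rfl⟩ : ∃ m, n = m + 1 + 1 := ⟨n - 2, by omega⟩
    refine (IsShortExact.ext_one_right_iff (K := N (m + 1)) (M := N (m + 1 + 1)) (hN (m + 1))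
      ((hF _).torZero I 0)).2 fun φ => ?_
    obtain ⟨ψ, hψ⟩ := (NTensor.exact_rmap_iff (A := I) (hd m).apply_apply_eq_zero).1 (hI I hinj m)
      (φ.comp (d (m + 1)).rangeRestrict) fun x => by
        rw [LinearMap.comp_apply, show (d (m + 1)).rangeRestrict (d m x) = 0 from
          Subtype.ext ((hd m).apply_apply_eq_zero x), map_zero]
    refine ⟨ψ, ?_⟩
    rintro ⟨_, y, rfl⟩
    exact hψ y
  | succ i ih =>
    obtain ⟨m, rfl⟩ : ∃ m, n = m + 1 := ⟨n - 1, by omega⟩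
    exact IsShortExact.ext_right (K := N m) (M := N (m + 1)) (hN m) (ih m) ((hF _).torZero I (i + 1))

/-- Splicing short exact sequences with flat middle terms gives complete flat resolutions. -/
theorem isGorensteinFlat_of_sequence {M : ModuleCat.{u} S} (N : ℤ → ModuleCat.{u} S)
    (e : M ≃ₗ[S] N 0) (hN : ∀ n, FlatStep (N n) (N (n + 1))) (hT : ∀ n, TorVanishes (N n)) :
    IsGorensteinFlat S M := by
  suffices H : ∀ L : ℤ → ModuleCat.{u} S, (M ≃ₗ[S] L (0 + 1)) →
      (∀ n, FlatStep (L n) (L (n + 1))) → (∀ n, TorVanishes (L n)) → IsGorensteinFlat S M by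
    refine H (fun n => N (n - 1)) (by simpa using e) (fun n => ?_) fun n => hT _
    have := hN (n - 1)
    rwa [show n - 1 + 1 = n + 1 - 1 by ring] at this
  intro L e hL hT
  choose F ι π hF h using hL
  have hexact (n : ℤ) : Function.Exact ((ι (n + 1)).comp (π n))
      ((ι (n + 1 + 1)).comp (π (n + 1))) := fun y => by
    rw [LinearMap.comp_apply, map_eq_zero_iff _ (h _).inj, (h (n + 1)).exact y]
    constructor
    · rintro ⟨x, rfl⟩
      obtain ⟨z, rfl⟩ := (h n).surj x
      exact ⟨z, rfl⟩
    · rintro ⟨z, rfl⟩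
      exact ⟨π n z, rfl⟩
  have hrange : LinearMap.range (ι (0 + 1)) = LinearMap.range ((ι (0 + 1)).comp (π 0)) :=
    (LinearMap.range_comp_of_range_eq_top _ (LinearMap.range_eq_top.2 (h 0).surj)).symm
  refine ⟨F, fun n => (ι (n + 1)).comp (π n), hF, hexact,
    ⟨e ≪≫ₗ LinearEquiv.ofInjective (ι (0 + 1)) (h _).inj ≪≫ₗ LinearEquiv.ofEq _ _ hrange⟩,
    fun I _ _ hI n => ?_⟩
  · refine (NTensor.exact_rmap_iff (hexact n).apply_apply_eq_zero).2 fun φ hφ => ?_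
    obtain ⟨χ, hχ⟩ := exists_linearMap_factor (h (n + 1)).surj φ fun y hy => by
      obtain ⟨x, rfl⟩ := ((h (n + 1)).exact y).1 hy
      obtain ⟨z, rfl⟩ := (h n).surj x
      exact hφ z
    obtain ⟨ψ, hψ⟩ := ((h (n + 1 + 1)).ext_one_right_iff
      ((hF _).torZero (ModuleCat.of Sᵐᵒᵖ I) 0)).1 (hT _ (ModuleCat.of Sᵐᵒᵖ I) hI 0) χ
    exact ⟨ψ, fun y => (hψ _).trans (hχ y)⟩

theorem IsGorensteinFlat.torVanishes {M : ModuleCat.{u} S} (hM : IsGorensteinFlat S M) :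
    TorVanishes M := by
  obtain ⟨N, ⟨e⟩, hN⟩ := hM.exists_sequence
  exact (hN 0).2.of_equiv e.symm

theorem IsGorensteinFlat.exists_flatStep {M : ModuleCat.{u} S} (hM : IsGorensteinFlat S M) :
    ∃ C : ModuleCat.{u} S, IsGorensteinFlat S C ∧ FlatStep M C := by
  obtain ⟨N, ⟨e⟩, hN⟩ := hM.exists_sequence
  refine ⟨N (0 + 1), isGorensteinFlat_of_sequence (fun n => N (n + 1)) (LinearEquiv.refl S _)
    (fun n => (hN _).1) (fun n => (hN _).2), (hN 0).1.of_equiv_left e⟩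

/-- A module with vanishing `Tor` that embeds into a flat module with Gorenstein flat cokernel is
Gorenstein flat. -/
theorem FlatStep.isGorensteinFlat {K C : ModuleCat.{u} S} (h : FlatStep K C)
    (hC : IsGorensteinFlat S C) (hK : TorVanishes K) : IsGorensteinFlat S K := by
  obtain ⟨N, ⟨e⟩, hN⟩ := hC.exists_sequence
  have hsyz (M : {M : ModuleCat.{u} S // TorVanishes M}) :
      ∃ L : {M : ModuleCat.{u} S // TorVanishes M}, FlatStep L.1 M.1 := by
    obtain ⟨L, P, ι, π, hs, hP⟩ := exists_projective_cover M.1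
    have hP := isFlatMod_of_projective hP
    exact ⟨⟨L, hs.torVanishes_left hP.torVanishes M.2⟩, P, ι, π, hP, hs⟩
  choose Ω hΩ using hsyz
  let L : ℤ → ModuleCat.{u} S
    | Int.ofNat 0 => K
    | Int.ofNat (k + 1) => N k
    | Int.negSucc k => (Ω^[k + 1] ⟨K, hK⟩).1
  refine isGorensteinFlat_of_sequence L (LinearEquiv.refl S K) (fun n => ?_) fun n => ?_
  · match n with
    | Int.ofNat 0 =>
      obtain ⟨F, ι, π, hF, h⟩ := h
      refine ⟨F, ι, e.toLinearMap.comp π, hF, h.inj, e.surjective.comp h.surj, fun y => ?_⟩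
      rw [LinearMap.comp_apply, LinearEquiv.coe_coe, map_eq_zero_iff _ e.injective]
      exact h.exact y
    | Int.ofNat (k + 1) => exact (hN k).1
    | Int.negSucc 0 => exact hΩ ⟨K, hK⟩
    | Int.negSucc (k + 1) =>
      change FlatStep (Ω^[k + 1 + 1] ⟨K, hK⟩).1 (Ω^[k + 1] ⟨K, hK⟩).1
      rw [Function.iterate_succ_apply']
      exact hΩ _
  · match n with
    | Int.ofNat 0 => exact hK
    | Int.ofNat (k + 1) => exact (hN k).2
    | Int.negSucc k => exact (Ω^[k + 1] ⟨K, hK⟩).2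

theorem IsFlatMod.isGorensteinFlat {M : ModuleCat.{u} S} (hM : IsFlatMod S M) :
    IsGorensteinFlat S M := by
  have h : IsShortExact (K := M) (G := ModuleCat.of S (M × M)) (M := M)
      (LinearMap.inl S M M) (LinearMap.snd S M M) :=
    ⟨LinearMap.inl_injective, LinearMap.snd_surjective, Function.Exact.inl_snd⟩
  have hF : IsFlatMod S (ModuleCat.of S (M × M)) := isFlatMod_of_torZero_one fun A =>
    h.ext_middle (hM.torZero A 0) (hM.torZero A 0)
  exact isGorensteinFlat_of_sequence (fun _ => M) (LinearEquiv.refl S M)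
    (fun _ => ⟨_, _, _, hF, h⟩) fun _ => hM.torVanishes

end GorensteinFlat

section Dimension

open CategoryTheory Abelian

variable {S : Type u} [Ring S]

/-- The pushout of two short exact sequences with a common first term. -/
theorem IsShortExact.exists_pushout {K G M F C : ModuleCat.{u} S} {i : K →ₗ[S] G} {p : G →ₗ[S] M}
    {j : K →ₗ[S] F} {q : F →ₗ[S] C} (h₁ : IsShortExact i p) (h₂ : IsShortExact j q) :
    ∃ (P : ModuleCat.{u} S) (a : G →ₗ[S] P) (b : P →ₗ[S] C) (c : F →ₗ[S] P) (e : P →ₗ[S] M),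
      IsShortExact a b ∧ IsShortExact c e := by
  let κ : K →ₗ[S] G × F := i.prod (-j)
  let mk : G × F →ₗ[S] ((G × F) ⧸ LinearMap.range κ) := (LinearMap.range κ).mkQ
  have hmk : Function.Surjective mk := Submodule.mkQ_surjective _
  have hker (x : G × F) : mk x = 0 ↔ ∃ k, i k = x.1 ∧ -j k = x.2 :=
    (Submodule.Quotient.mk_eq_zero _).trans (exists_congr fun k => Prod.ext_iff)
  obtain ⟨b, hb⟩ := exists_linearMap_factor hmk (q.comp (LinearMap.snd S G F)) fun x hx => by
    obtain ⟨k, -, hk⟩ := (hker x).1 hx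
    simp [← hk, h₂.exact.apply_apply_eq_zero]
  obtain ⟨e, he⟩ := exists_linearMap_factor hmk (p.comp (LinearMap.fst S G F)) fun x hx => by
    obtain ⟨k, hk, -⟩ := (hker x).1 hx
    simp [← hk, h₁.exact.apply_apply_eq_zero]
  refine ⟨ModuleCat.of S ((G × F) ⧸ LinearMap.range κ), mk.comp (LinearMap.inl S G F), b,
    mk.comp (LinearMap.inr S G F), e, ⟨?_, ?_, ?_⟩, ⟨?_, ?_, ?_⟩⟩
  · refine (injective_iff_map_eq_zero _).2 fun g hg => ?_
    obtain ⟨k, hk, hk'⟩ := (hker (g, 0)).1 hg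
    have : k = 0 := (map_eq_zero_iff j h₂.inj).1 (neg_eq_zero.1 hk')
    simpa [this] using hk.symm
  · intro c
    obtain ⟨f, rfl⟩ := h₂.surj c
    exact ⟨mk (0, f), hb (0, f)⟩
  · intro y
    obtain ⟨⟨g, f⟩, rfl⟩ := hmk y
    constructor
    · intro hy
      obtain ⟨k, hk⟩ := (h₂.exact f).1 ((hb (g, f)).symm.trans hy)
      refine ⟨g + i k, sub_eq_zero.1 ?_⟩
      rw [LinearMap.comp_apply, ← map_sub]
      exact (hker _).2 ⟨k, by simp, by simp [hk]⟩
    · rintro ⟨x, hx⟩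
      rw [← hx]
      exact (hb (x, 0)).trans (map_zero q)
  · refine (injective_iff_map_eq_zero _).2 fun f hf => ?_
    obtain ⟨k, hk, hk'⟩ := (hker (0, f)).1 hf
    have : k = 0 := (map_eq_zero_iff i h₁.inj).1 hk
    simpa [this] using hk'.symm
  · intro m
    obtain ⟨g, rfl⟩ := h₁.surj m
    exact ⟨mk (g, 0), he (g, 0)⟩
  · intro y
    obtain ⟨⟨g, f⟩, rfl⟩ := hmk y
    constructor
    · intro hy
      obtain ⟨k, hk⟩ := (h₁.exact g).1 ((he (g, f)).symm.trans hy)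
      refine ⟨f + j k, sub_eq_zero.1 ?_⟩
      rw [LinearMap.comp_apply, ← map_sub]
      exact (hker _).2 ⟨-k, by simp [hk], by simp⟩
    · rintro ⟨x, hx⟩
      rw [← hx]
      exact (he (0, x)).trans (map_zero p)

/-- The third isomorphism theorem for `F ⊆ P ⊆ E`. -/
theorem IsShortExact.exists_quotient {F P K E C : ModuleCat.{u} S} {c : F →ₗ[S] P}
    {e : P →ₗ[S] K} {a : P →ₗ[S] E} {b : E →ₗ[S] C} (h₁ : IsShortExact c e)
    (h₂ : IsShortExact a b) :
    ∃ (Q : ModuleCat.{u} S) (q : E →ₗ[S] Q) (i : K →ₗ[S] Q) (p : Q →ₗ[S] C),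
      IsShortExact (a.comp c) q ∧ IsShortExact i p := by
  let q : E →ₗ[S] (E ⧸ LinearMap.range (a.comp c)) := (LinearMap.range (a.comp c)).mkQ
  have hq : Function.Surjective q := Submodule.mkQ_surjective _
  have hker (x : E) : q x = 0 ↔ ∃ f, a (c f) = x := Submodule.Quotient.mk_eq_zero _
  obtain ⟨i, hi⟩ := exists_linearMap_factor h₁.surj (q.comp a) fun x hx => by
    obtain ⟨f, rfl⟩ := (h₁.exact x).1 hx
    exact (hker _).2 ⟨f, rfl⟩
  obtain ⟨p, hp⟩ := exists_linearMap_factor hq b fun x hx => by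
    obtain ⟨f, rfl⟩ := (hker x).1 hx
    exact h₂.exact.apply_apply_eq_zero _
  refine ⟨ModuleCat.of S (E ⧸ LinearMap.range (a.comp c)), q, i, p,
    ⟨h₂.inj.comp h₁.inj, hq, hker⟩, ⟨?_, ?_, ?_⟩⟩
  · refine (injective_iff_map_eq_zero _).2 fun k hk => ?_
    obtain ⟨x, rfl⟩ := h₁.surj k
    obtain ⟨f, hf⟩ := (hker _).1 ((hi x).symm.trans hk)
    rw [← h₂.inj hf]
    exact h₁.exact.apply_apply_eq_zero f
  · intro y
    obtain ⟨x, rfl⟩ := h₂.surj y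
    exact ⟨q x, hp x⟩
  · intro y
    obtain ⟨x, rfl⟩ := hq y
    rw [hp x, h₂.exact x]
    constructor
    · rintro ⟨z, rfl⟩
      exact ⟨e z, hi z⟩
    · rintro ⟨k, hk⟩
      obtain ⟨z, rfl⟩ := h₁.surj k
      obtain ⟨f, hf⟩ := (hker (x - a z)).1 (by rw [map_sub, ← hk, hi z]; exact sub_self _)
      exact ⟨z + c f, by rw [map_add, hf]; abel⟩

/-- Over a GF-closed ring, a module of finite Gorenstein flat dimension with vanishing `Tor`
against injectives is Gorenstein flat. -/
theorem IsGFClosed.isGorensteinFlat_of_torVanishes (hS : IsGFClosed S) {n : ℕ}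
    {K : ModuleCat.{u} S} (hK : gflatDimLE S n K) (hT : TorVanishes K) : IsGorensteinFlat S K := by
  induction n generalizing K with
  | zero => exact hK
  | succ n ih =>
    obtain ⟨L, G, i, p, hi, hp, hip, hG, hL⟩ := hK
    have h : IsShortExact i p := ⟨hi, hp, hip⟩
    obtain ⟨C, hC, F, j, q, hF, hF'⟩ :=
      (ih hL (h.torVanishes_left hG.torVanishes hT)).exists_flatStep
    obtain ⟨P, a, b, c, e, hab, hce⟩ := h.exists_pushout hF'
    have hP : IsGorensteinFlat S P := hS G P C a b hab.inj hab.surj hab.exact hG hC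
    obtain ⟨D, hD, E, u, v, hE, hE'⟩ := hP.exists_flatStep
    obtain ⟨Q, q', i', p', hQ, hQ'⟩ := hce.exists_quotient hE'
    have hQflat : IsFlatMod S Q := isFlatMod_of_torZero_one fun A => by
      obtain ⟨I, B, f, g, hfg, hI⟩ := exists_injective_hull A
      exact hfg.torZero_left (hQ'.ext_middle (hT I hI 0) (hD.torVanishes I hI 0))
        (hQ.ext_right (hF.torZero B 0) (hE.torZero B 1))
    exact FlatStep.isGorensteinFlat ⟨Q, i', p', hQflat, hQ'⟩ hD hT

theorem torZero_of_gflatDimLE {n : ℕ} {M : ModuleCat.{u} S} (hM : gflatDimLE S n M)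
    {I : ModuleCat.{u} Sᵐᵒᵖ} (hI : Module.Injective Sᵐᵒᵖ I) {i : ℕ} (hi : n ≤ i) :
    TorZero I M (i + 1) := by
  induction n generalizing M i with
  | zero => exact IsGorensteinFlat.torVanishes hM I hI i
  | succ n ih =>
    obtain ⟨K, G, ι, π, hι, hπ, hιπ, hG, hK⟩ := hM
    obtain ⟨i, rfl⟩ : ∃ k, i = k + 1 := ⟨i - 1, by omega⟩
    exact IsShortExact.ext_right ⟨hι, hπ, hιπ⟩ (ih hK (by omega)) (hG.torVanishes I hI (i + 1))

theorem IsGFClosed.gflatDimLE_of_torZero (hS : IsGFClosed S)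
    (hfin : ∀ M : ModuleCat.{u} S, ∃ k, gflatDimLE S k M) {n : ℕ} {M : ModuleCat.{u} S}
    (hM : ∀ I : ModuleCat.{u} Sᵐᵒᵖ, Module.Injective Sᵐᵒᵖ I → ∀ i, n ≤ i → TorZero I M (i + 1)) :
    gflatDimLE S n M := by
  induction n generalizing M with
  | zero =>
    obtain ⟨k, hk⟩ := hfin M
    exact hS.isGorensteinFlat_of_torVanishes hk fun I hI i => hM I hI i i.zero_le
  | succ n ih =>
    obtain ⟨K, P, ι, π, h, hP⟩ := exists_projective_cover M
    refine ⟨K, P, ι, π, h.inj, h.surj, h.exact, (isFlatMod_of_projective hP).isGorensteinFlat,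
      ih fun I hI i hi => ?_⟩
    exact h.ext_left (subsingleton_ext_of_projective hP) (hM I hI (i + 1) (by omega))

theorem exists_gflatDimLE_of_gorensteinWeakGlobalDim_le {n : ℕ}
    (h : gorensteinWeakGlobalDim S ≤ n) (M : ModuleCat.{u} S) : ∃ k ≤ n, gflatDimLE S k M := by
  have hM : gflatDim S M < (n + 1 : ℕ) :=
    ((le_iSup (gflatDim S) M).trans h).trans_lt (by exact_mod_cast n.lt_succ_self)
  obtain ⟨_, ⟨k, rfl, hk⟩, hlt⟩ := sInf_lt_iff.1 hM
  exact ⟨k, Nat.lt_succ_iff.1 (by exact_mod_cast hlt), hk⟩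

theorem rightInjTorZero_of_gorensteinWeakGlobalDim_le {n : ℕ}
    (h : gorensteinWeakGlobalDim S ≤ n) : RightInjTorZero S n := fun I hI M i hi => by
  obtain ⟨k, hk, hM⟩ := exists_gflatDimLE_of_gorensteinWeakGlobalDim_le h M
  exact torZero_of_gflatDimLE hM hI (hk.trans hi)

theorem IsGFClosed.gorensteinWeakGlobalDim_le (hS : IsGFClosed S)
    {m n : ℕ} (hm : gorensteinWeakGlobalDim S ≤ m) (hn : RightInjTorZero S n) :
    gorensteinWeakGlobalDim S ≤ n := by
  refine iSup_le fun M => sInf_le ⟨n, rfl, hS.gflatDimLE_of_torZero (fun N => ?_) fun I hI i hi =>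
    hn I hI M i hi⟩
  obtain ⟨k, -, hk⟩ := exists_gflatDimLE_of_gorensteinWeakGlobalDim_le hm N
  exact ⟨k, hk⟩

end Dimension

/-- **Theorem 2.1.**  If `R` is a GF-closed ring with finite left and right weak Gorenstein
global dimensions, then `l.Gwdim(R) = r.Gwdim(R)`. -/
theorem gorensteinWeakGlobalDim_eq_of_isGFClosed (R : Type u) [Ring R]
    (hl : IsGFClosed R) (hr : IsGFClosed Rᵐᵒᵖ)
    (hfl : gorensteinWeakGlobalDim R ≠ ⊤) (hfr : gorensteinWeakGlobalDim Rᵐᵒᵖ ≠ ⊤) :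
    gorensteinWeakGlobalDim R = gorensteinWeakGlobalDim Rᵐᵒᵖ := by
  obtain ⟨n, hn⟩ := ENat.ne_top_iff_exists.1 hfl
  obtain ⟨m, hm⟩ := ENat.ne_top_iff_exists.1 hfr
  have hright : RightInjTorZero R n := rightInjTorZero_of_gorensteinWeakGlobalDim_le hn.ge
  have hleft : LeftInjTorZero R m := (leftInjTorZero_iff_rightInjTorZero_op m).2
    (rightInjTorZero_of_gorensteinWeakGlobalDim_le hm.ge)
  apply le_antisymm
  · rw [← hm]
    exact hl.gorensteinWeakGlobalDim_le hn.ge (hright.of_leftInjTorZero hleft)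
  · rw [← hn]
    exact hr.gorensteinWeakGlobalDim_le hm.ge
      ((leftInjTorZero_iff_rightInjTorZero_op n).1 (hleft.of_rightInjTorZero hright))
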